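/- Let K be a field, p a prime different from the characteristic of K, and n ≥ 1. Then: (1) every finite abelian p-subgroup of GL_n(K) can be generated by at most n elements; and (2) for every finite subgroup H ≤ GL_n(K) and every normal subgroup N of H such that H/N is an elementary abelian p-group of rank r, one has r·(p−1) ≤ p·n. In particular, rk_p(GL_n(K)) ≤ n and the sectional p-rank of GL_n(K) is at most pn/(p−1). -/

import Mathlib

open Pointwise

section FixingSubgroup

variable {K V G : Type*} [Field K] [AddCommGroup V] [Module K V] [Group G] [DistribMulAction G V]

theorem Submodule.fixingSubgroup_bot :
    fixingSubgroup G ((⊥ : Submodule K V) : Set V) = ⊤ :=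
  eq_top_iff.2 fun _ _ => (mem_fixingSubgroup_iff G).2 fun v hv => by
    rw [(Submodule.mem_bot K).1 hv, smul_zero]

theorem Submodule.fixingSubgroup_sup (U W : Submodule K V) :
    fixingSubgroup G ((U ⊔ W : Submodule K V) : Set V) =
      fixingSubgroup G (U : Set V) ⊓ fixingSubgroup G (W : Set V) := by
  refine le_antisymm (le_inf (fixingSubgroup_antitone G V (le_sup_left (a := U)))
    (fixingSubgroup_antitone G V (le_sup_right (a := U)))) fun g hg => ?_
  refine (mem_fixingSubgroup_iff G).2 fun v hv => ?_
  obtain ⟨u, hu, w, hw, rfl⟩ := Submodule.mem_sup.1 hv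
  rw [smul_add, (mem_fixingSubgroup_iff G).1 hg.1 u hu, (mem_fixingSubgroup_iff G).1 hg.2 w hw]

/-- A relation between subgroups which is additive in chains and holds for the subgroups fixing
each of the `U i` pointwise also holds for the subgroup fixing their sum pointwise. -/
theorem Submodule.fixingSubgroup_finset_sup_induction {ι : Type*}
    {R : Subgroup G → Subgroup G → ℕ → Prop} (refl : ∀ M, R M M 0)
    (trans : ∀ A B C m n, A ≤ B → B ≤ C → R A B m → R B C n → R A C (m + n))
    {Q : Subgroup G} {U : ι → Submodule K V} {f : ι → ℕ} (s : Finset ι)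
    (step : ∀ i ∈ s, ∀ M ≤ Q, R (M ⊓ fixingSubgroup G (U i : Set V)) M (f i)) :
    R (Q ⊓ fixingSubgroup G ((s.sup U : Submodule K V) : Set V)) Q (∑ i ∈ s, f i) := by
  classical
  induction s using Finset.induction_on with
  | empty =>
    rw [Finset.sup_empty, Submodule.fixingSubgroup_bot, inf_top_eq, Finset.sum_empty]
    exact refl Q
  | insert i s hi ih =>
    rw [Finset.sup_insert, Submodule.fixingSubgroup_sup, Finset.sum_insert hi,
      inf_comm (fixingSubgroup G (U i : Set V)), ← inf_assoc]
    exact trans _ _ _ _ _ inf_le_left inf_le_left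
      (step i (Finset.mem_insert_self i s) _ inf_le_left)
      (ih fun j hj => step j (Finset.mem_insert_of_mem hj))

end FixingSubgroup

section GroupActions

variable {K V G : Type*} [Field K] [AddCommGroup V] [Module K V]
  [Group G] [DistribMulAction G V] [SMulCommClass G K V]

/-- The eigenvectors in `W` of the group element `x`, for the eigenvalue `μ`. -/
def Submodule.groupEigenspace (W : Submodule K V) (x : G) (μ : K) : Submodule K V :=
  W ⊓ Module.End.eigenspace (DistribSMul.toLinearMap K V x) μ

theorem Submodule.mem_groupEigenspace {W : Submodule K V} {x : G} {μ : K} {v : V} :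
    v ∈ W.groupEigenspace x μ ↔ v ∈ W ∧ x • v = μ • v := by
  simp [Submodule.groupEigenspace]

theorem Submodule.groupEigenspace_le (W : Submodule K V) (x : G) (μ : K) :
    W.groupEigenspace x μ ≤ W :=
  inf_le_left

theorem Submodule.iSupIndep_groupEigenspace (W : Submodule K V) (x : G) :
    iSupIndep (W.groupEigenspace x) :=
  (Module.End.eigenspaces_iSupIndep _).mono fun _ => inf_le_right

theorem iSupIndep.sum_finrank_eq {ι : Type*} [FiniteDimensional K V] {U : ι → Submodule K V}
    (hU : iSupIndep U) (s : Finset ι) :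
    ∑ i ∈ s, Module.finrank K (U i) = Module.finrank K (s.sup U : Submodule K V) := by
  classical
  induction s using Finset.induction_on with
  | empty => rw [Finset.sum_empty, Finset.sup_empty, finrank_bot]
  | insert i s hi ih =>
    have hdisj : Disjoint (U i) (s.sup U) :=
      (hU.supIndep' (insert i s)) (Finset.subset_insert i s) (Finset.mem_insert_self i s) hi
    rw [Finset.sum_insert hi, ih, Finset.sup_insert, ← Submodule.finrank_sup_add_finrank_inf_eq,
      hdisj.eq_bot]
    simp

theorem isSemisimple_toLinearMap_of_orderOf_ne_zero [FiniteDimensional K V] {x : G}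
    (hx : (orderOf x : K) ≠ 0) :
    Module.End.IsSemisimple (DistribSMul.toLinearMap K V x) := by
  refine Module.End.isSemisimple_of_squarefree_aeval_eq_zero
    (Polynomial.separable_X_pow_sub_C (1 : K) hx one_ne_zero).squarefree ?_
  have hpow : ∀ k : ℕ, (DistribSMul.toLinearMap K V x : Module.End K V) ^ k =
      DistribSMul.toLinearMap K V (x ^ k) := fun k =>
    (map_pow (DistribMulAction.toModuleEnd K V) x k).symm
  ext v
  simp [hpow, pow_orderOf_eq_one]

/-- A submodule stable under `x` is the direct sum of finitely many eigenspaces of `x`. -/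
theorem Submodule.exists_finset_groupEigenspace [IsAlgClosed K] [FiniteDimensional K V]
    {x : G} (hx : (orderOf x : K) ≠ 0) {W : Submodule K V} (hW : ∀ v ∈ W, x • v ∈ W) :
    ∃ s : Finset K, (∀ μ, μ ∈ s ↔ W.groupEigenspace x μ ≠ ⊥) ∧
      s.sup (W.groupEigenspace x) = W ∧
      ∑ μ ∈ s, Module.finrank K (W.groupEigenspace x μ) = Module.finrank K W := by
  have hfin := WellFoundedGT.finite_ne_bot_of_iSupIndep (W.iSupIndep_groupEigenspace (K := K) x)
  have hmem : ∀ μ, μ ∈ hfin.toFinset ↔ W.groupEigenspace x μ ≠ ⊥ := by simp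
  have hsup : hfin.toFinset.sup (W.groupEigenspace x) = W := by
    have h := Submodule.eq_iSup_inf_genEigenspace (p := W) (f := DistribSMul.toLinearMap K V x)
      1 hW (isSemisimple_toLinearMap_of_orderOf_ne_zero hx).iSup_eigenspace_eq_top
    refine le_antisymm (Finset.sup_le fun μ _ => W.groupEigenspace_le x μ) ?_
    conv_lhs => rw [h]
    refine iSup_le fun μ => ?_
    by_cases hμ : W.groupEigenspace x μ = ⊥
    · exact hμ.le.trans bot_le
    · exact Finset.le_sup (f := W.groupEigenspace x) ((hmem μ).2 hμ)
  refine ⟨_, hmem, hsup, ?_⟩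
  rw [(W.iSupIndep_groupEigenspace x).sum_finrank_eq, hsup]

theorem Submodule.finrank_groupEigenspace_lt [FiniteDimensional K V] {x : G} {W : Submodule K V}
    (hx : ¬ ∃ c : K, ∀ v ∈ W, x • v = c • v) (μ : K) :
    Module.finrank K (W.groupEigenspace x μ) < Module.finrank K W := by
  refine Submodule.finrank_lt_finrank_of_lt ((W.groupEigenspace_le x μ).lt_of_ne fun h => hx ⟨μ, ?_⟩)
  intro v hv
  rw [← h] at hv
  exact (Submodule.mem_groupEigenspace.1 hv).2

/-- A finite group of scalars is cyclic modulo the elements acting trivially. -/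
theorem Subgroup.exists_zpowers_sup_fixingSubgroup_eq {M : Subgroup G} [Finite M]
    {W : Submodule K V} (hW : W ≠ ⊥) (hM : ∀ g ∈ M, ∃ c : K, ∀ v ∈ W, g • v = c • v) :
    ∃ g ∈ M, M = Subgroup.zpowers g ⊔ (M ⊓ fixingSubgroup G (W : Set V)) := by
  obtain ⟨w, hw, hw0⟩ := W.ne_bot_iff.1 hW
  choose! c hc using hM
  let χ : M →* K :=
    { toFun := fun g => c g
      map_one' := by
        refine smul_left_injective K hw0 ?_
        simp [← hc 1 M.one_mem w hw]
      map_mul' := fun a b => by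
        refine smul_left_injective K hw0 ?_
        simp only [Subgroup.coe_mul]
        rw [← hc _ (M.mul_mem a.2 b.2) w hw, mul_smul, hc _ b.2 w hw, smul_comm, hc _ a.2 w hw,
          smul_smul, mul_comm] }
  have hcyc : IsCyclic χ.toHomUnits.range :=
    haveI : Finite χ.toHomUnits.range := Set.finite_range χ.toHomUnits
    inferInstance
  obtain ⟨⟨_, g, rfl⟩, hg⟩ := hcyc.exists_generator
  refine ⟨g, g.2, le_antisymm (fun h hh => ?_) (sup_le ?_ inf_le_left)⟩
  · obtain ⟨k, hk⟩ := Subgroup.mem_zpowers_iff.1 (hg ⟨_, ⟨h, hh⟩, rfl⟩)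
    have hk' : χ.toHomUnits (g ^ k) = χ.toHomUnits ⟨h, hh⟩ := by
      rw [map_zpow]; exact congrArg Subtype.val hk
    have hχ : χ ((g ^ k)⁻¹ * ⟨h, hh⟩) = 1 := by
      rw [← MonoidHom.coe_toHomUnits, map_mul, map_inv, hk']; simp
    have : h = (g : G) ^ k * (((g : G) ^ k)⁻¹ * h) := by group
    rw [this]
    have hmem : ((g : G) ^ k)⁻¹ * h ∈ M := M.mul_mem (M.inv_mem (M.zpow_mem g.2 k)) hh
    refine Subgroup.mul_mem_sup (Subgroup.zpow_mem_zpowers _ k) ⟨hmem, ?_⟩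
    refine (mem_fixingSubgroup_iff G).2 fun v hv => ?_
    have h1 : c (((g : G) ^ k)⁻¹ * h) = 1 := hχ
    rw [hc _ hmem v hv, h1, one_smul]
  · simp

/-- A finite commutative group acting on `W` is generated, modulo the elements acting trivially,
by at most `dim W` elements. -/
theorem Subgroup.exists_finset_closure_sup_fixingSubgroup_eq [IsAlgClosed K]
    [FiniteDimensional K V] [Finite G] (hcomm : ∀ a b : G, a * b = b * a)
    (hord : ∀ x : G, (orderOf x : K) ≠ 0) (W : Submodule K V) (M : Subgroup G)
    (hM : ∀ g ∈ M, ∀ v ∈ W, g • v ∈ W) :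
    ∃ t : Finset G, t.card ≤ Module.finrank K W ∧
      M = Subgroup.closure (t : Set G) ⊔ (M ⊓ fixingSubgroup G (W : Set V)) := by
  classical
  induction hn : Module.finrank K W using Nat.strong_induction_on generalizing W M with
  | _ n ih =>
  subst hn
  by_cases hscal : ∀ g ∈ M, ∃ c : K, ∀ v ∈ W, g • v = c • v
  · rcases eq_or_ne W ⊥ with rfl | hW
    · exact ⟨∅, by simp, by rw [Submodule.fixingSubgroup_bot]; simp⟩
    · obtain ⟨g, -, hg⟩ := Subgroup.exists_zpowers_sup_fixingSubgroup_eq hW hscal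
      refine ⟨{g}, ?_, by rwa [Finset.coe_singleton, ← Subgroup.zpowers_eq_closure]⟩
      rw [Finset.card_singleton]
      exact Submodule.one_le_finrank_iff.2 hW
  · push Not at hscal
    obtain ⟨x, hxM, hx⟩ := hscal
    obtain ⟨s, -, hsup, hsum⟩ :=
      Submodule.exists_finset_groupEigenspace (hord x) (hM x hxM)
    have key := Submodule.fixingSubgroup_finset_sup_induction (G := G)
      (R := fun A B n => ∃ t : Finset G, t.card ≤ n ∧ B = Subgroup.closure (t : Set G) ⊔ A)
      (fun M => ⟨∅, by simp, by simp⟩)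
      (by
        rintro A B C m n - - ⟨t, ht, hB⟩ ⟨u, hu, hC⟩
        refine ⟨u ∪ t, (Finset.card_union_le u t).trans (by omega), ?_⟩
        rw [Finset.coe_union, Subgroup.closure_union, sup_assoc, ← hB, ← hC])
      (Q := M) (U := W.groupEigenspace x)
      (f := fun μ => Module.finrank K (W.groupEigenspace x μ)) s
      (fun μ _ N hN => ih _ (Submodule.finrank_groupEigenspace_lt (by push Not; exact hx) μ) _ _
        (fun g hg v hv => by
          rw [Submodule.mem_groupEigenspace] at hv ⊢
          refine ⟨hM g (hN hg) v hv.1, ?_⟩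
          rw [← mul_smul, hcomm, mul_smul, hv.2, smul_comm]) rfl)
    rwa [hsup, hsum] at key

/-- A `p`-group not acting on `W` by scalars contains an element which does not act by a scalar,
but commutes with the group up to scalars. -/
theorem IsPGroup.exists_not_scalar_of_not_forall_scalar {p : ℕ} [Fact p.Prime]
    {M : Subgroup G} [Finite M] (hp : IsPGroup p M) {W : Submodule K V}
    (hM : ∀ g ∈ M, ∀ v ∈ W, g • v ∈ W)
    (hscal : ¬ ∀ g ∈ M, ∃ c : K, ∀ v ∈ W, g • v = c • v) :
    ∃ x ∈ M, (¬ ∃ c : K, ∀ v ∈ W, x • v = c • v) ∧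
      ∀ g ∈ M, ∃ c : K, ∀ v ∈ W, x • g • v = c • g • x • v := by
  let S : Subgroup M :=
    { carrier := {g | ∃ c : K, ∀ v ∈ W, (g : G) • v = c • v}
      one_mem' := ⟨1, by simp⟩
      mul_mem' := by
        rintro a b ⟨c, hc⟩ ⟨d, hd⟩
        refine ⟨c * d, fun v hv => ?_⟩
        rw [Subgroup.coe_mul, mul_smul, hd v hv, hc _ (W.smul_mem d hv), mul_smul]
      inv_mem' := by
        rintro a ⟨c, hc⟩
        refine ⟨c⁻¹, fun v hv => ?_⟩
        rw [Subgroup.coe_inv, inv_smul_eq_iff, smul_comm, hc v hv]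
        rcases eq_or_ne c 0 with rfl | h
        · have := hc v hv
          rw [zero_smul, smul_eq_zero_iff_eq] at this
          simp [this]
        · rw [inv_smul_smul₀ h] }
  have hSn : S.Normal := ⟨by
    rintro a ⟨c, hc⟩ g
    refine ⟨c, fun v hv => ?_⟩
    have h := hc _ (hM _ (M.inv_mem g.2) v hv)
    rw [Subgroup.coe_mul, Subgroup.coe_mul, mul_smul, mul_smul, Subgroup.coe_inv, h, smul_comm,
      smul_inv_smul]⟩
  have hS : S ≠ ⊤ := fun h => hscal fun g hg => (h ▸ Subgroup.mem_top _ : (⟨g, hg⟩ : M) ∈ S)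
  have : Nontrivial (M ⧸ S) := QuotientGroup.nontrivial_iff.2 hS
  have := (hp.to_quotient S).center_nontrivial
  obtain ⟨⟨z, hz⟩, hz1⟩ := exists_ne (1 : Subgroup.center (M ⧸ S))
  obtain ⟨x, rfl⟩ := QuotientGroup.mk_surjective z
  refine ⟨x, x.2, fun hx => hz1 (Subtype.ext ((QuotientGroup.eq_one_iff x).2 hx)), ?_⟩
  intro g hg
  have h := Subgroup.mem_center_iff.1 hz (QuotientGroup.mk (⟨g, hg⟩ : M))
  rw [← QuotientGroup.mk_mul, ← QuotientGroup.mk_mul, QuotientGroup.eq] at h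
  obtain ⟨c, hc⟩ := h
  refine ⟨c, fun v hv => ?_⟩
  have h := hc v hv
  simp only [Subgroup.coe_mul, Subgroup.coe_inv] at h
  rw [mul_smul, inv_smul_eq_iff, mul_smul, mul_smul] at h
  rw [h, ← smul_comm g c, ← smul_comm (x : G) c]

/-- The elements commuting with `x` up to scalars permute the eigenspaces of `x`. -/
theorem Submodule.smul_groupEigenspace {x g : G} {W : Submodule K V} {c : K} (hc : c ≠ 0)
    (hg : g • W = W) (h : ∀ v ∈ W, x • g • v = c • g • x • v) (μ : K) :
    g • W.groupEigenspace x μ = W.groupEigenspace x (c * μ) := by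
  ext v
  have hW : v ∈ W ↔ g⁻¹ • v ∈ W := by
    conv_lhs => rw [← hg]
    exact Submodule.mem_smul_pointwise_iff_exists _ _ _ |>.trans
      ⟨by rintro ⟨w, hw, rfl⟩; simpa using hw, fun h => ⟨_, h, by simp⟩⟩
  have : v ∈ g • W.groupEigenspace x μ ↔ g⁻¹ • v ∈ W.groupEigenspace x μ :=
    Submodule.mem_smul_pointwise_iff_exists _ _ _ |>.trans
      ⟨by rintro ⟨w, hw, rfl⟩; simpa using hw, fun h => ⟨_, h, by simp⟩⟩
  rw [this, Submodule.mem_groupEigenspace, Submodule.mem_groupEigenspace, ← hW]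
  refine and_congr_right fun hv => ?_
  have h' := h _ (hW.1 hv)
  rw [smul_inv_smul] at h'
  rw [h', mul_smul, smul_right_inj hc, ← smul_left_cancel_iff g, smul_comm g μ, smul_inv_smul]

theorem Subgroup.relIndex_map_dvd {E : Type*} [Group E] (φ : G →* E) (A B : Subgroup G) :
    (A.map φ).relIndex (B.map φ) ∣ A.relIndex B := by
  rw [← Subgroup.relIndex_comap]
  exact Subgroup.relIndex_dvd_of_le_left _ (Subgroup.le_comap_map φ A)

/-- The stabilizer of an eigenspace of `x` has index at most the number of eigenspaces. -/
theorem Submodule.relIndex_stabilizer_groupEigenspace_le {x : G} {M : Subgroup G}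
    {W : Submodule K V} (hM : ∀ g ∈ M, g • W = W) {s : Finset K}
    (hs : ∀ μ, W.groupEigenspace x μ ≠ ⊥ → μ ∈ s)
    (h : ∀ g ∈ M, ∃ c : K, c ≠ 0 ∧ ∀ v ∈ W, x • g • v = c • g • x • v)
    {μ : K} (hμ : W.groupEigenspace x μ ≠ ⊥) :
    (MulAction.stabilizer G (W.groupEigenspace x μ)).relIndex M ≤ s.card := by
  have hindex : (MulAction.stabilizer G (W.groupEigenspace x μ)).relIndex M =
      (MulAction.orbit M (W.groupEigenspace x μ)).ncard :=
    MulAction.index_stabilizer M (W.groupEigenspace x μ)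
  rw [hindex, ← Set.ncard_coe_finset s]
  refine (Set.ncard_le_ncard ?_ (s.finite_toSet.image (W.groupEigenspace x))).trans
    (Set.ncard_image_le s.finite_toSet)
  rintro _ ⟨g, rfl⟩
  obtain ⟨c, hc, hgc⟩ := h g g.2
  have hsmul := Submodule.smul_groupEigenspace hc (hM g g.2) hgc μ
  refine ⟨c * μ, hs _ ?_, hsmul.symm⟩
  rw [← hsmul]
  exact fun h0 => hμ (by rw [← inv_smul_smul (g : G) (W.groupEigenspace x μ), h0]; simp)

theorem Nat.pow_sub_one_le_of_le {p : ℕ} (hp : 1 ≤ p) {k m : ℕ} (h : p ^ k ≤ m) :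
    (p ^ k) ^ (p - 1) ≤ p ^ (m - 1) := by
  rw [← pow_mul]
  refine Nat.pow_le_pow_right hp ?_
  have hb : 1 + k * (p - 1) ≤ p ^ k := by
    obtain ⟨q, rfl⟩ := Nat.exists_eq_add_of_le hp
    simpa using one_add_le_pow_of_two_add_nonneg (Nat.zero_le (2 + q)) k
  omega

/-- For a finite `p`-group `M` acting on `W` in characteristic different from `p`, a bound for the
index of the image of the elements acting trivially under a homomorphism to an abelian group of
exponent `p`. -/
theorem IsPGroup.relIndex_map_fixingSubgroup_le [IsAlgClosed K] [FiniteDimensional K V]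
    [Finite G] {p : ℕ} [hp : Fact p.Prime] (hpK : (p : K) ≠ 0) (hG : IsPGroup p G)
    {E : Type*} [CommGroup E] (hE : ∀ e : E, e ^ p = 1) (φ : G →* E)
    {W : Submodule K V} (hW : W ≠ ⊥) (M : Subgroup G) (hM : ∀ g ∈ M, ∀ v ∈ W, g • v ∈ W) :
    ((M ⊓ fixingSubgroup G (W : Set V)).map φ).relIndex (M.map φ) ^ (p - 1) ≤
      p ^ (p * Module.finrank K W - 1) := by
  induction hn : Module.finrank K W using Nat.strong_induction_on generalizing W M with
  | _ n ih =>
  subst hn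
  have hW1 : 1 ≤ Module.finrank K W := Submodule.one_le_finrank_iff.2 hW
  by_cases hscal : ∀ g ∈ M, ∃ c : K, ∀ v ∈ W, g • v = c • v
  · obtain ⟨g, -, hg⟩ := Subgroup.exists_zpowers_sup_fixingSubgroup_eq hW hscal
    have hle : ((M ⊓ fixingSubgroup G (W : Set V)).map φ).relIndex (M.map φ) ≤ p := by
      conv_lhs => rw [hg, Subgroup.map_sup, ← hg, Subgroup.relIndex_sup_right, MonoidHom.map_zpowers]
      refine Nat.le_of_dvd hp.out.pos ((Subgroup.relIndex_dvd_card _ _).trans ?_)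
      rw [Nat.card_zpowers]
      exact orderOf_dvd_of_pow_eq_one (hE _)
    refine (Nat.pow_le_pow_left hle _).trans (Nat.pow_le_pow_right hp.out.pos ?_)
    exact Nat.sub_le_sub_right (Nat.le_mul_of_pos_right p hW1) 1
  · obtain ⟨x, hxM, hx, hcomm⟩ := (hG.to_subgroup M).exists_not_scalar_of_not_forall_scalar hM hscal
    have hord : (orderOf x : K) ≠ 0 := by
      obtain ⟨k, hk⟩ := IsPGroup.iff_orderOf.1 hG x
      rw [hk, Nat.cast_pow]
      exact pow_ne_zero k hpK
    obtain ⟨s, hs, hsup, hsum⟩ := Submodule.exists_finset_groupEigenspace hord (hM x hxM)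
    have hsne : s.Nonempty := by
      rw [Finset.nonempty_iff_ne_empty]
      rintro rfl
      exact hW (by rw [← hsup, Finset.sup_empty])
    obtain ⟨μ, hμ⟩ := id hsne
    have hsmul : ∀ g ∈ M, g • W = W := by
      intro g hg
      refine le_antisymm ?_ fun v hv => Submodule.mem_smul_pointwise_iff_exists _ _ _ |>.2
        ⟨g⁻¹ • v, hM _ (M.inv_mem hg) v hv, by simp⟩
      rintro _ ⟨v, hv, rfl⟩
      exact hM g hg v hv
    obtain ⟨w, hw, hw0⟩ := (Submodule.ne_bot_iff _).1 ((hs μ).1 hμ)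
    rw [Submodule.mem_groupEigenspace] at hw
    have hcomm' : ∀ g ∈ M, ∃ c : K, c ≠ 0 ∧ ∀ v ∈ W, x • g • v = c • g • x • v := by
      intro g hg
      obtain ⟨c, hc⟩ := hcomm g hg
      refine ⟨c, ?_, hc⟩
      rintro rfl
      have := hc w hw.1
      simp [smul_eq_zero_iff_eq, hw0] at this
    have hμ0 : μ ≠ 0 := by
      rintro rfl
      have := hw.2
      simp [smul_eq_zero_iff_eq, hw0] at this
    set Q := M ⊓ MulAction.stabilizer G (W.groupEigenspace x μ) with hQ
    have hQM : Q ≤ M := inf_le_left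
    have hcent : ∀ g ∈ Q, ∀ v ∈ W, x • g • v = g • x • v := by
      rintro g ⟨hgM, hgs⟩ v hv
      obtain ⟨c, hc, hgc⟩ := hcomm' g hgM
      have hstab := Submodule.smul_groupEigenspace hc (hsmul g hgM) hgc μ
      rw [MulAction.mem_stabilizer_iff.1 hgs] at hstab
      have hw' : w ∈ W.groupEigenspace x (c * μ) := hstab ▸ Submodule.mem_groupEigenspace.2 hw
      have heq : μ = c * μ := smul_left_injective K hw0
        (hw.2.symm.trans (Submodule.mem_groupEigenspace.1 hw').2)
      rw [hgc v hv, (mul_eq_right₀ hμ0).1 heq.symm, one_smul]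
    have hfix := Submodule.fixingSubgroup_finset_sup_induction (G := G)
      (R := fun A B n => (A.map φ).relIndex (B.map φ) ^ (p - 1) ≤ p ^ n)
      (fun M => by simp)
      (fun A B C m n hAB hBC h₁ h₂ => by
        rw [← Subgroup.relIndex_mul_relIndex _ _ _ (Subgroup.map_mono hAB)
          (Subgroup.map_mono hBC), mul_pow, pow_add]
        exact Nat.mul_le_mul h₁ h₂)
      (Q := Q) (U := W.groupEigenspace x)
      (f := fun μ => p * Module.finrank K (W.groupEigenspace x μ) - 1) s
      (fun μ hμ N hN => ih _ (Submodule.finrank_groupEigenspace_lt hx μ) ((hs μ).1 hμ) N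
        (fun g hg v hv => by
          rw [Submodule.mem_groupEigenspace] at hv ⊢
          refine ⟨hM g (hN hg).1 v hv.1, ?_⟩
          rw [hcent g (hN hg) v hv.1, hv.2, smul_comm]) rfl)
    rw [hsup] at hfix
    have hindex : (Q.map φ).relIndex (M.map φ) ^ (p - 1) ≤ p ^ (s.card - 1) := by
      have : Finite (M.map φ) := (Set.toFinite (M : Set G)).image φ
      obtain ⟨k, hk⟩ := IsPGroup.iff_card.1 ((hG.to_subgroup M).map φ)
      obtain ⟨j, -, hj⟩ := (Nat.dvd_prime_pow hp.out).1
        (hk ▸ Subgroup.relIndex_dvd_card (Q.map φ) (M.map φ))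
      have hle : (Q.map φ).relIndex (M.map φ) ≤ s.card := by
        refine (Nat.le_of_dvd (Nat.pos_of_ne_zero ?_) (Subgroup.relIndex_map_dvd φ Q M)).trans ?_
        · exact Subgroup.FiniteIndex.index_ne_zero
        · rw [hQ, Subgroup.inf_relIndex_left]
          exact Submodule.relIndex_stabilizer_groupEigenspace_le hsmul (fun μ h => (hs μ).2 h)
            hcomm' ((hs μ).1 hμ)
      rw [hj] at hle ⊢
      exact Nat.pow_sub_one_le_of_le hp.out.one_lt.le hle
    have hsum' : ∑ μ ∈ s, (p * Module.finrank K (W.groupEigenspace x μ) - 1) + s.card =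
        p * Module.finrank K W := by
      rw [Finset.card_eq_sum_ones, ← Finset.sum_add_distrib, ← hsum, Finset.mul_sum]
      refine Finset.sum_congr rfl fun μ hμ => Nat.sub_add_cancel ?_
      exact Nat.mul_pos hp.out.pos (Submodule.one_le_finrank_iff.2 ((hs μ).1 hμ))
    have hchain := Subgroup.relIndex_mul_relIndex _ _ _
      (Subgroup.map_mono (f := φ) (inf_le_left (a := Q) (b := fixingSubgroup G (W : Set V))))
      (Subgroup.map_mono (f := φ) hQM)
    calc _ ≤ ((Q ⊓ fixingSubgroup G (W : Set V)).map φ).relIndex (M.map φ) ^ (p - 1) := by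
            refine Nat.pow_le_pow_left (Nat.le_of_dvd (Nat.pos_of_ne_zero ?_)
              (Subgroup.relIndex_dvd_of_le_left _
                (Subgroup.map_mono (inf_le_inf_right _ hQM)))) _
            have : Finite (M.map φ) := (Set.toFinite (M : Set G)).image φ
            exact Subgroup.FiniteIndex.index_ne_zero
      _ ≤ p ^ (∑ μ ∈ s, (p * Module.finrank K (W.groupEigenspace x μ) - 1)) *
            p ^ (s.card - 1) := by
            rw [← hchain, mul_pow]
            exact Nat.mul_le_mul hfix hindex
      _ = p ^ (p * Module.finrank K W - 1) := by
            rw [← pow_add, ← hsum', Nat.add_sub_assoc (Finset.card_pos.2 hsne)]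

end GroupActions

section Representations

variable {K V G : Type*} [Field K] [IsAlgClosed K] [AddCommGroup V] [Module K V]
  [FiniteDimensional K V] [Group G] [Finite G] {p : ℕ} [hp : Fact p.Prime]

/-- A finite abelian `p`-group with a faithful representation of dimension `d` in characteristic
different from `p` is generated by at most `d` elements. -/
theorem IsPGroup.exists_closure_eq_top_of_injective (hpK : (p : K) ≠ 0) (hG : IsPGroup p G)
    (hcomm : ∀ a b : G, a * b = b * a) (ρ : G →* Module.End K V) (hρ : Function.Injective ρ) :
    ∃ t : Finset G, t.card ≤ Module.finrank K V ∧ Subgroup.closure (t : Set G) = ⊤ := by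
  let _ : DistribMulAction G V := DistribMulAction.compHom V ρ
  have hsmul : ∀ (g : G) (v : V), g • v = ρ g v := fun _ _ => rfl
  have : SMulCommClass G K V := ⟨fun g c v => by rw [hsmul, hsmul, map_smul]⟩
  have hord : ∀ x : G, (orderOf x : K) ≠ 0 := fun x => by
    obtain ⟨k, hk⟩ := IsPGroup.iff_orderOf.1 hG x
    rw [hk, Nat.cast_pow]
    exact pow_ne_zero k hpK
  have hfix : fixingSubgroup G ((⊤ : Submodule K V) : Set V) = ⊥ :=
    eq_bot_iff.2 fun g hg => hρ <| by
      ext v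
      simpa [hsmul] using (mem_fixingSubgroup_iff G).1 hg v trivial
  obtain ⟨t, ht, htop⟩ := Subgroup.exists_finset_closure_sup_fixingSubgroup_eq hcomm hord
    (⊤ : Submodule K V) ⊤ fun _ _ _ _ => trivial
  rw [hfix, inf_bot_eq, sup_bot_eq] at htop
  exact ⟨t, ht.trans (finrank_top K V).le, htop.symm⟩

/-- An abelian quotient of exponent `p` of a finite `p`-group with a faithful representation of
dimension `d` in characteristic different from `p` has order `p ^ r` with
`r * (p - 1) ≤ p * d - 1`. -/
theorem IsPGroup.card_pow_le_of_injective [Nontrivial V] (hpK : (p : K) ≠ 0) (hG : IsPGroup p G)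
    (ρ : G →* Module.End K V) (hρ : Function.Injective ρ)
    {E : Type*} [CommGroup E] (hE : ∀ e : E, e ^ p = 1) (φ : G →* E)
    (hφ : Function.Surjective φ) :
    Nat.card E ^ (p - 1) ≤ p ^ (p * Module.finrank K V - 1) := by
  let _ : DistribMulAction G V := DistribMulAction.compHom V ρ
  have hsmul : ∀ (g : G) (v : V), g • v = ρ g v := fun _ _ => rfl
  have : SMulCommClass G K V := ⟨fun g c v => by rw [hsmul, hsmul, map_smul]⟩
  have hfix : fixingSubgroup G ((⊤ : Submodule K V) : Set V) = ⊥ :=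
    eq_bot_iff.2 fun g hg => hρ <| by
      ext v
      simpa [hsmul] using (mem_fixingSubgroup_iff G).1 hg v trivial
  have h := hG.relIndex_map_fixingSubgroup_le hpK hE φ (top_ne_bot : (⊤ : Submodule K V) ≠ ⊥) ⊤
    fun _ _ _ _ => trivial
  rwa [hfix, inf_bot_eq, Subgroup.map_bot, Subgroup.relIndex_bot_left,
    Subgroup.map_top_of_surjective φ hφ, Subgroup.card_top, finrank_top] at h

end Representations

theorem Matrix.GeneralLinearGroup.exists_injective_hom_end (K L : Type*) [Field K] [Field L]
    [Algebra K L] (n : ℕ) :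
    ∃ ρ : Matrix.GeneralLinearGroup (Fin n) K →* Module.End L (Fin n → L),
      Function.Injective ρ := by
  refine ⟨((Matrix.toLinAlgEquiv' (R := L) (n := Fin n) : _ →* _).comp
    (Units.coeHom _)).comp (Matrix.GeneralLinearGroup.map (algebraMap K L)), ?_⟩
  refine ((Matrix.toLinAlgEquiv' (R := L) (n := Fin n)).injective.comp Units.val_injective).comp ?_
  intro a b hab
  ext i j
  exact (algebraMap K L).injective (by simpa using congrArg (fun g => g i j) hab)

/-- Let `K` be a field, `p` a prime different from the characteristic
of `K`, and `n ≥ 1`.  Then (1) every finite abelian `p`-subgroup of `GL_n(K)` is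
generated by at most `n` elements; and (2) for every finite subgroup `H ≤ GL_n(K)` and
normal subgroup `N ⊴ H` with `H ⧸ N` elementary abelian of rank `r`, one has
`r * (p - 1) ≤ p * n`.  (Hence `rk_p(GL_n(K)) ≤ n` and `srk_p(GL_n(K)) ≤ pn/(p-1)`.) -/
theorem rank_and_sectional_rank_GL_bound
    (K : Type*) [Field K] (p : ℕ) [Fact p.Prime] (hchar : ringChar K ≠ p)
    (n : ℕ) (hn : 1 ≤ n) :
    (∀ H : Subgroup (Matrix.GeneralLinearGroup (Fin n) K), Finite H → IsPGroup p H →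
        (∀ a ∈ H, ∀ b ∈ H, a * b = b * a) →
        ∃ s : Finset (Matrix.GeneralLinearGroup (Fin n) K),
          s.card ≤ n ∧ Subgroup.closure (s : Set (Matrix.GeneralLinearGroup (Fin n) K)) = H) ∧
    (∀ H : Subgroup (Matrix.GeneralLinearGroup (Fin n) K), Finite H →
      ∀ (N : Subgroup H) [N.Normal],
      ∀ r : ℕ, Nonempty ((H ⧸ N) ≃* Multiplicative (Fin r → ZMod p)) →
        r * (p - 1) ≤ p * n) := by
  have hp := Fact.out (p := p.Prime)
  have hpK : (p : AlgebraicClosure K) ≠ 0 := by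
    rw [← map_natCast (algebraMap K (AlgebraicClosure K)), Ne, map_eq_zero, ringChar.spec]
    intro h
    rcases (Nat.dvd_prime hp).1 h with h1 | h1
    · exact CharP.ringChar_ne_one h1
    · exact hchar h1
  obtain ⟨ρ, hρ⟩ := Matrix.GeneralLinearGroup.exists_injective_hom_end K (AlgebraicClosure K) n
  refine ⟨fun H _ hH hcomm => ?_, fun H _ N _ r ⟨e⟩ => ?_⟩
  · classical
    obtain ⟨t, ht, htop⟩ := hH.exists_closure_eq_top_of_injective hpK
      (fun a b => Subtype.ext (hcomm a a.2 b b.2)) (ρ.comp H.subtype)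
      (hρ.comp H.subtype_injective)
    refine ⟨t.image H.subtype, Finset.card_image_le.trans (by simpa using ht), ?_⟩
    rw [Finset.coe_image, ← MonoidHom.map_closure, htop, ← MonoidHom.range_eq_map,
      Subgroup.range_subtype]
  · have : Nonempty (Fin n) := ⟨⟨0, hn⟩⟩
    let φ : H →* Multiplicative (Fin r → ZMod p) := e.toMonoidHom.comp (QuotientGroup.mk' N)
    have hφ : Function.Surjective φ := e.surjective.comp (QuotientGroup.mk'_surjective N)
    have hE : ∀ a : Multiplicative (Fin r → ZMod p), a ^ p = 1 := fun a => by
      refine Multiplicative.toAdd.injective ?_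
      ext i
      simp
    let P : Sylow p H := default
    have hcard : Nat.card (Multiplicative (Fin r → ZMod p)) = p ^ r := by
      simp [Nat.card_eq_fintype_card]
    have hsurj : Function.Surjective (φ.comp (P : Subgroup H).subtype) := by
      rw [← MonoidHom.range_eq_top, MonoidHom.range_comp, Subgroup.range_subtype]
      exact ((P.mapSurjective hφ).is_maximal'
          (Q := ⊤) (IsPGroup.of_card (n := r) (by rw [Subgroup.card_top, hcard])) le_top).symm
    have h := P.isPGroup'.card_pow_le_of_injective hpK
      (ρ.comp (H.subtype.comp (P : Subgroup H).subtype))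
      (hρ.comp (H.subtype_injective.comp (P : Subgroup H).subtype_injective)) hE _ hsurj
    rw [hcard, ← pow_mul, Module.finrank_fin_fun] at h
    exact ((Nat.pow_le_pow_iff_right hp.one_lt).1 h).trans (Nat.sub_le _ _)
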